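/- Let r > 0, let G be a finite simple graph on vertices {1,…,N} with neighbor relation j ∼ k, let e₁, e₂ ∈ ℝ² be linearly independent, let A = (a₁,…,a_N) ∈ (ℝ²)^N be such that ‖a_k − a_j‖_Λ > 2r for every edge j ∼ k, and let u ∈ ℝ^N with U = Σ_{k=1}^N Σ_{j∼k} (u_k + u_j)² > 0. Set h(A) = Σ_{k=1}^N Σ_{j∼k} ‖a_k − a_j‖_Λ². Then the quantity M = (1/U)·(Σ_{k=1}^N Σ_{j∼k} (u_k + u_j)⁴)^{1/2} · h(A)^{1/2} satisfies M > 2r, and the discrete energy satisfies E(u, A) = Σ_{k=1}^N Σ_{j∼k} g(‖a_k − a_j‖_Λ)(u_k + u_j)² ≥ U · g(M). -/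

import Mathlib

open scoped BigOperators

/-- Keller's interparticle flux function `g(x) = π √(r/(x - 2r))`. -/
noncomputable def keller (r x : ℝ) : ℝ := Real.pi * Real.sqrt (r / (x - 2 * r))

/-- The torus distance `‖a − b‖_Λ = inf_{(l₁,l₂)∈ℤ²} |a − b + l₁e₁ + l₂e₂|`. -/
noncomputable def torusDist (e₁ e₂ a b : EuclideanSpace ℝ (Fin 2)) : ℝ :=
  ⨅ l : ℤ × ℤ, ‖a - b + (l.1 : ℝ) • e₁ + (l.2 : ℝ) • e₂‖

lemma keller_tangent (r M x : ℝ) (hM : 2 * r < M) (hx : 2 * r < x) :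
    1 / √(M - 2 * r) - (x - M) / (2 * √(M - 2 * r) ^ 3) ≤ 1 / √(x - 2 * r) := by
  have ha : 0 < √(x - 2 * r) := Real.sqrt_pos.2 (by linarith)
  have hb : 0 < √(M - 2 * r) := Real.sqrt_pos.2 (by linarith)
  have ha2 : √(x - 2 * r) ^ 2 = x - 2 * r := Real.sq_sqrt (by linarith)
  have hb2 : √(M - 2 * r) ^ 2 = M - 2 * r := Real.sq_sqrt (by linarith)
  have hd : x - M = √(x - 2 * r) ^ 2 - √(M - 2 * r) ^ 2 := by rw [ha2, hb2]; ring
  rw [hd]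
  generalize √(x - 2 * r) = a at *
  generalize √(M - 2 * r) = b at *
  have key : 1 / a - (1 / b - (a ^ 2 - b ^ 2) / (2 * b ^ 3))
      = (a - b) ^ 2 * (a + 2 * b) / (2 * a * b ^ 3) := by
    field_simp
    ring
  have : 0 ≤ (a - b) ^ 2 * (a + 2 * b) / (2 * a * b ^ 3) := by positivity
  linarith

lemma keller_eq (r x : ℝ) (hr : 0 < r) : keller r x = Real.pi * √r * (1 / √(x - 2 * r)) := by
  unfold keller
  rw [Real.sqrt_div hr.le]
  ring

lemma jensen_aux {ι : Type*} (s : Finset ι) (r : ℝ) (hr : 0 < r) (w x : ι → ℝ)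
    (hw : ∀ i ∈ s, 0 ≤ w i) (hx : ∀ i ∈ s, 2 * r < x i) (U M : ℝ)
    (hU : U = ∑ i ∈ s, w i) (hUpos : 0 < U)
    (hM : M = (1 / U) * (√(∑ i ∈ s, w i ^ 2) * √(∑ i ∈ s, x i ^ 2))) :
    2 * r < M ∧ U * keller r M ≤ ∑ i ∈ s, keller r (x i) * w i := by
  have hCS : ∑ i ∈ s, w i * x i ≤ U * M := by
    have h := Real.sum_mul_le_sqrt_mul_sqrt s w x
    have : U * M = √(∑ i ∈ s, w i ^ 2) * √(∑ i ∈ s, x i ^ 2) := by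
      rw [hM]; field_simp
    linarith
  have hlt : U * (2 * r) < ∑ i ∈ s, w i * x i := by
    rw [hU, Finset.sum_mul]
    obtain ⟨i, hi, hpos⟩ : ∃ i ∈ s, 0 < w i := by
      by_contra! hcon
      have := Finset.sum_nonpos hcon
      linarith
    exact Finset.sum_lt_sum
      (fun i hi => mul_le_mul_of_nonneg_left (hx i hi).le (hw i hi))
      ⟨i, hi, mul_lt_mul_of_pos_left (hx i hi) hpos⟩
  have hMr : 2 * r < M := lt_of_mul_lt_mul_left (hlt.trans_le hCS) hUpos.le
  refine ⟨hMr, ?_⟩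
  have hb : 0 < √(M - 2 * r) := Real.sqrt_pos.2 (by linarith)
  have h1 : ∑ i ∈ s, (1 / √(M - 2 * r) - (x i - M) / (2 * √(M - 2 * r) ^ 3)) * w i
      ≤ ∑ i ∈ s, 1 / √(x i - 2 * r) * w i :=
    Finset.sum_le_sum fun i hi =>
      mul_le_mul_of_nonneg_right (keller_tangent r M (x i) hMr (hx i hi)) (hw i hi)
  have h2 : ∑ i ∈ s, (1 / √(M - 2 * r) - (x i - M) / (2 * √(M - 2 * r) ^ 3)) * w i
      = U * (1 / √(M - 2 * r))
        + (U * M - ∑ i ∈ s, w i * x i) * (1 / (2 * √(M - 2 * r) ^ 3)) := by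
    rw [hU, sub_mul, Finset.sum_mul, Finset.sum_mul, Finset.sum_mul, Finset.sum_mul,
      ← Finset.sum_sub_distrib, ← Finset.sum_add_distrib]
    refine Finset.sum_congr rfl fun i _ => ?_
    ring
  have h3 : 0 ≤ (U * M - ∑ i ∈ s, w i * x i) * (1 / (2 * √(M - 2 * r) ^ 3)) :=
    mul_nonneg (by linarith) (by positivity)
  have h4 : U * (1 / √(M - 2 * r)) ≤ ∑ i ∈ s, 1 / √(x i - 2 * r) * w i := by linarith
  have h5 : ∑ i ∈ s, keller r (x i) * w i
      = Real.pi * √r * ∑ i ∈ s, 1 / √(x i - 2 * r) * w i := by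
    rw [Finset.mul_sum]
    refine Finset.sum_congr rfl fun i _ => ?_
    rw [keller_eq r _ hr]; ring
  rw [h5, keller_eq r M hr]
  calc _ = Real.pi * √r * (U * (1 / √(M - 2 * r))) := by ring
    _ ≤ _ := mul_le_mul_of_nonneg_left h4 (by positivity)

/-- Combined Jensen–Hölder lower bound for the discrete energy:
with `M = (1/U)·(Σ (u_k+u_j)⁴)^{1/2}·h(A)^{1/2}` one has `M > 2r` and `E(u,A) ≥ U·g(M)`. -/
theorem discrete_energy_jensen_holder_bound (r : ℝ) (hr : 0 < r) (N : ℕ)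
    (G : SimpleGraph (Fin N)) [DecidableRel G.Adj]
    (e₁ e₂ : EuclideanSpace ℝ (Fin 2)) (he : LinearIndependent ℝ ![e₁, e₂])
    (A : Fin N → EuclideanSpace ℝ (Fin 2))
    (hA : ∀ k j, G.Adj k j → 2 * r < torusDist e₁ e₂ (A k) (A j))
    (u : Fin N → ℝ) (U : ℝ)
    (hU : U = ∑ k, ∑ j ∈ G.neighborFinset k, (u k + u j) ^ 2)
    (hUpos : 0 < U) (M : ℝ)
    (hM : M = (1 / U) *
        (Real.sqrt (∑ k, ∑ j ∈ G.neighborFinset k, (u k + u j) ^ 4) *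
         Real.sqrt (∑ k, ∑ j ∈ G.neighborFinset k, (torusDist e₁ e₂ (A k) (A j)) ^ 2))) :
    2 * r < M ∧
    U * keller r M ≤
      ∑ k, ∑ j ∈ G.neighborFinset k,
        keller r (torusDist e₁ e₂ (A k) (A j)) * (u k + u j) ^ 2 := by
  rw [Finset.sum_sigma'] at hU hM ⊢
  rw [Finset.sum_sigma'] at hM
  refine jensen_aux (Finset.univ.sigma fun k => G.neighborFinset k) r hr
    (fun p => (u p.1 + u p.2) ^ 2) (fun p => torusDist e₁ e₂ (A p.1) (A p.2))
    (fun p _ => sq_nonneg _) (fun p hp => hA _ _ ?_) U M hU hUpos ?_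
  · simpa using hp
  · rw [hM]
    simp only [← pow_mul]
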